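/- arXiv:1008.4812 — 2 statements merged into one kernel-verified Lean document; each statement's English description precedes it below -/
import Mathlib

section
/- For every integer k ≥ 1, lim_{m→∞} Σ_{σ ∈ P(2k)} m^{−(k+1−v(σ))} = C_k, the k-th Catalan number (1/(k+1)) · C(2k, k); that is, as m → ∞ the limiting even spectral moments of the symmetric m-block circulant ensemble converge to the moments of the semicircle distribution. -/
open Filter

/-- A pairing: a fixed-point-free involution of `ZMod n`. -/
abbrev Pairing (n : ℕ) : Type :=
  {σ : Equiv.Perm (ZMod n) // (∀ j, σ (σ j) = j) ∧ ∀ j, σ j ≠ j}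

noncomputable instance (n : ℕ) [NeZero n] : Fintype (Pairing n) :=
  Fintype.ofFinite _

/-- `v(σ)`: the number of equivalence classes of `ZMod n` under the smallest equivalence
relation relating `j` and `σ j + 1`. -/
noncomputable def vfun (n : ℕ) (σ : Equiv.Perm (ZMod n)) : ℕ :=
  Nat.card (Quot (fun a b : ZMod n => b = σ a + 1))

open Finset in
/-- Noncrossing involutions of `Fin n` with support exactly `[a,b)`. -/
noncomputable def NCF (n a b : ℕ) : Finset (Fin n → Fin n) :=
  open Classical in
  univ.filter fun f => (∀ x, f (f x) = x) ∧ (∀ x, f x ≠ x ↔ (a ≤ x.val ∧ x.val < b)) ∧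
    ∀ i j, ¬ (i.val < j.val ∧ j.val < (f i).val ∧ (f i).val < (f j).val)

lemma mem_NCF {n a b : ℕ} {f : Fin n → Fin n} : f ∈ NCF n a b ↔
    (∀ x, f (f x) = x) ∧ (∀ x, f x ≠ x ↔ (a ≤ x.val ∧ x.val < b)) ∧
    ∀ i j, ¬ (i.val < j.val ∧ j.val < (f i).val ∧ (f i).val < (f j).val) := by
  simp [NCF]

/-- gluing -/
def glue {n : ℕ} (a j : Fin n) (f g : Fin n → Fin n) : Fin n → Fin n := fun x =>
  if x = a then j else if x = j then a else if a.val < x.val ∧ x.val < j.val then f x else g x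

/-- restriction to the half-open interval -/
def restr {n : ℕ} (a b : ℕ) (f : Fin n → Fin n) : Fin n → Fin n := fun x =>
  if a ≤ x.val ∧ x.val < b then f x else x

lemma NCF_maps {n a b : ℕ} {f : Fin n → Fin n} (h : f ∈ NCF n a b) (x : Fin n)
    (hx : a ≤ x.val ∧ x.val < b) : a ≤ (f x).val ∧ (f x).val < b := by
  obtain ⟨h1, h2, h3⟩ := mem_NCF.1 h
  rw [← h2, h1]
  exact fun h => (h2 x).2 hx h.symm

lemma NCF_fix {n a b : ℕ} {f : Fin n → Fin n} (h : f ∈ NCF n a b) (x : Fin n)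
    (hx : ¬ (a ≤ x.val ∧ x.val < b)) : f x = x := by
  obtain ⟨h1, h2, h3⟩ := mem_NCF.1 h
  rw [← h2] at hx
  exact not_not.1 hx

lemma glue_mem {n b : ℕ} {a j : Fin n} (haj : a.val < j.val) (hjb : j.val < b)
    {f g : Fin n → Fin n} (hf : f ∈ NCF n (a.val + 1) j.val) (hg : g ∈ NCF n (j.val + 1) b) :
    glue a j f g ∈ NCF n a.val b := by
  have fm := NCF_maps hf
  have gm := NCF_maps hg
  have gf := NCF_fix hg
  obtain ⟨f1, f2, f3⟩ := mem_NCF.1 hf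
  obtain ⟨g1, g2, g3⟩ := mem_NCF.1 hg
  have e1 : glue a j f g a = j := by simp [glue]
  have e2 : glue a j f g j = a := by simp [glue]
  have e3 : ∀ x : Fin n, a.val < x.val → x.val < j.val → glue a j f g x = f x := by
    intro x h1 h2
    have : x ≠ a := by rintro rfl; omega
    have : x ≠ j := by rintro rfl; omega
    simp [glue, *]
  have e4 : ∀ x : Fin n, j.val < x.val → x.val < b → glue a j f g x = g x := by
    intro x h1 h2
    have : x ≠ a := by rintro rfl; omega
    have : x ≠ j := by rintro rfl; omega
    have : ¬ (a.val < x.val ∧ x.val < j.val) := by omega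
    simp only [glue]
    rw [if_neg, if_neg, if_neg this] <;> assumption
  have e5 : ∀ x : Fin n, x.val < a.val ∨ b ≤ x.val → glue a j f g x = x := by
    intro x h1
    have : x ≠ a := by rintro rfl; omega
    have : x ≠ j := by rintro rfl; omega
    have h6 : ¬ (a.val < x.val ∧ x.val < j.val) := by omega
    simp only [glue]
    rw [if_neg, if_neg, if_neg h6, gf] <;> first | assumption | omega
  have cases : ∀ x : Fin n, x = a ∨ x = j ∨ (a.val < x.val ∧ x.val < j.val) ∨
      (j.val < x.val ∧ x.val < b) ∨ (x.val < a.val ∨ b ≤ x.val) := by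
    intro x
    rw [Fin.ext_iff, Fin.ext_iff]; omega
  refine mem_NCF.2 ⟨?_, ?_, ?_⟩
  · intro x
    rcases cases x with rfl | rfl | h | h | h
    · rw [e1, e2]
    · rw [e2, e1]
    · have := fm x (by omega)
      rw [e3 x h.1 h.2, e3 _ (by omega) (by omega), f1]
    · have := gm x (by omega)
      rw [e4 x h.1 h.2, e4 _ (by omega) (by omega), g1]
    · rw [e5 x h, e5 x h]
  · intro x
    rcases cases x with rfl | rfl | h | h | h
    · rw [e1, ne_eq, Fin.ext_iff]; omega
    · rw [e2, ne_eq, Fin.ext_iff]; omega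
    · rw [e3 x h.1 h.2, f2]; omega
    · rw [e4 x h.1 h.2, g2]; omega
    · rw [e5 x h]; simp; omega
  · intro x y
    have fx := fm x
    have fy := fm y
    have gx := gm x
    have gy := gm y
    have := f3 x y
    have := g3 x y
    have vals : ∀ x : Fin n, (x.val = a.val ∧ (glue a j f g x).val = j.val) ∨
        (x.val = j.val ∧ (glue a j f g x).val = a.val) ∨
        ((a.val < x.val ∧ x.val < j.val) ∧ (glue a j f g x).val = (f x).val) ∨
        ((j.val < x.val ∧ x.val < b) ∧ (glue a j f g x).val = (g x).val) ∨
        ((x.val < a.val ∨ b ≤ x.val) ∧ (glue a j f g x).val = x.val) := by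
      intro x
      rcases cases x with h | h | h | h | h
      · left; rw [h, e1]; simp
      · right; left; rw [h, e2]; simp
      · right; right; left; rw [e3 x h.1 h.2]; exact ⟨h, rfl⟩
      · right; right; right; left; rw [e4 x h.1 h.2]; exact ⟨h, rfl⟩
      · right; right; right; right; rw [e5 x h]; exact ⟨h, rfl⟩
    have vx := vals x
    have vy := vals y
    omega

lemma restr_mem {n a b c d : ℕ} {f : Fin n → Fin n} (hf : f ∈ NCF n a b) (hac : a ≤ c) (hdb : d ≤ b)
    (hm : ∀ x : Fin n, c ≤ x.val → x.val < d → c ≤ (f x).val ∧ (f x).val < d) :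
    restr c d f ∈ NCF n c d := by
  obtain ⟨f1, f2, f3⟩ := mem_NCF.1 hf
  have e1 : ∀ x : Fin n, (c ≤ x.val ∧ x.val < d) → restr c d f x = f x := by
    intro x h; simp only [restr]; rw [if_pos h]
  have e2 : ∀ x : Fin n, ¬ (c ≤ x.val ∧ x.val < d) → restr c d f x = x := by
    intro x h; simp only [restr]; rw [if_neg h]
  refine mem_NCF.2 ⟨?_, ?_, ?_⟩
  · intro x
    by_cases h : c ≤ x.val ∧ x.val < d
    · rw [e1 x h, e1 _ (hm x h.1 h.2), f1]
    · rw [e2 x h, e2 x h]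
  · intro x
    by_cases h : c ≤ x.val ∧ x.val < d
    · rw [e1 x h, f2]; omega
    · rw [e2 x h]; simp; omega
  · intro x y
    have := f3 x y
    have hx := hm x
    have hy := hm y
    by_cases h : c ≤ x.val ∧ x.val < d <;> by_cases h' : c ≤ y.val ∧ y.val < d
    · rw [e1 x h, e1 y h']; exact this
    · rw [e1 x h, e2 y h']; omega
    · rw [e2 x h]; omega
    · rw [e2 x h]; omega

open Finset in
lemma fiber_card {n b : ℕ} {a j : Fin n} (haj : a.val < j.val) (hjb : j.val < b) :
    #{f ∈ NCF n a.val b | f a = j} = #(NCF n (a.val + 1) j.val) * #(NCF n (j.val + 1) b) := by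
  rw [← card_product]
  symm
  refine card_nbij' (fun p => glue a j p.1 p.2)
    (fun f => (restr (a.val + 1) j.val f, restr (j.val + 1) b f)) ?_ ?_ ?_ ?_
  · rintro ⟨f, g⟩ h
    simp only [coe_product, Set.mem_prod, mem_coe] at h
    simp only [coe_filter, Set.mem_ofPred_eq]
    exact ⟨glue_mem haj hjb h.1 h.2, by simp [glue]⟩
  · intro f h
    simp only [coe_filter, Set.mem_ofPred_eq] at h
    obtain ⟨h, hj⟩ := h
    have fm := NCF_maps h
    obtain ⟨f1, f2, f3⟩ := mem_NCF.1 h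
    have hja : f j = a := by rw [← hj, f1]
    have inj : ∀ x y, f x = f y → x = y := fun x y h => by rw [← f1 x, h, f1]
    simp only [coe_product, Set.mem_prod, mem_coe]
    have key : ∀ x : Fin n, x ≠ a → x ≠ j → (f x).val ≠ a.val ∧ (f x).val ≠ j.val := by
      intro x h1 h2
      refine ⟨fun h => h2 (inj _ _ ?_), fun h => h1 (inj _ _ ?_)⟩
      · rw [hja]; exact Fin.ext h
      · rw [hj]; exact Fin.ext h
    constructor
    · refine restr_mem h (by omega) (by omega) ?_
      intro x h1 h2
      have k1 := key x (by rintro rfl; omega) (by rintro rfl; omega)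
      have := f3 a x
      have := fm x (by omega)
      rw [hj] at *
      omega
    · refine restr_mem h (by omega) (by omega) ?_
      intro x h1 h2
      have k1 := key x (by rintro rfl; omega) (by rintro rfl; omega)
      have := f3 a (f x)
      have := fm x (by omega)
      rw [hj, f1] at *
      omega
  · rintro ⟨f, g⟩ h
    simp only [coe_product, Set.mem_prod, mem_coe] at h
    have ff := NCF_fix h.1
    have gf := NCF_fix h.2
    simp only [Prod.mk.injEq]
    constructor <;> funext x <;> simp only [restr, glue]
    · split_ifs with h1 h2 h3 h4
      · subst h2; omega
      · subst h3; omega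
      · rfl
      · omega
      · exact (ff x h1).symm
    · split_ifs with h1 h2 h3 h4
      · subst h2; omega
      · subst h3; omega
      · omega
      · rfl
      · exact (gf x h1).symm
  · intro f h
    simp only [coe_filter, Set.mem_ofPred_eq] at h
    obtain ⟨h, hj⟩ := h
    have ff := NCF_fix h
    obtain ⟨f1, f2, f3⟩ := mem_NCF.1 h
    have hja : f j = a := by rw [← hj, f1]
    funext x
    simp only [restr, glue]
    split_ifs with h1 h2 h3 h4 h5
    · rw [h1, hj]
    · rw [h2, hja]
    · rfl
    · omega
    · rfl
    · refine (ff x ?_).symm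
      rw [Fin.ext_iff] at h1 h2
      omega

open Finset in
lemma NCF_rec {n a L : ℕ} (h : a + L + 1 ≤ n) :
    #(NCF n a (a + L + 1)) = ∑ i ∈ range L, #(NCF n (a + 1) (a + 1 + i)) *
      #(NCF n (a + i + 2) (a + L + 1)) := by
  have ha : a < n := by omega
  set a' : Fin n := ⟨a, ha⟩ with ha'
  rw [card_eq_sum_card_fiberwise (f := fun f => (f a').val - (a + 1)) (t := range L)]
  · refine sum_congr rfl fun i hi => ?_
    rw [mem_range] at hi
    have hj : a + 1 + i < n := by omega
    have := fiber_card (n := n) (b := a + L + 1) (a := a') (j := ⟨a + 1 + i, hj⟩)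
      (by simp [ha']; omega) (by simp; omega)
    simp only [ha'] at this
    rw [show a + i + 2 = a + 1 + i + 1 by ring, ← this]
    congr 1
    refine filter_congr fun f hf => ?_
    have hm := NCF_maps hf a' (by simp [ha'])
    have hne := (mem_NCF.1 hf).2.1 a'
    rw [ne_eq, Fin.ext_iff] at hne
    rw [Fin.ext_iff]
    simp [ha'] at *
    omega
  · intro f hf
    have hm := NCF_maps hf a' (by simp [ha'])
    have hne := (mem_NCF.1 hf).2.1 a'
    rw [ne_eq, Fin.ext_iff] at hne
    simp [ha'] at *
    omega

open Finset in
lemma NCF_zero (n a : ℕ) : #(NCF n a a) = 1 := by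
  rw [card_eq_one]
  refine ⟨id, ?_⟩
  ext f
  rw [mem_singleton]
  constructor
  · intro h
    funext x
    exact NCF_fix h x (by omega)
  · rintro rfl
    rw [mem_NCF]
    refine ⟨fun _ => rfl, fun x => ?_, fun i j => ?_⟩ 
    · simp; 
    · simp; omega

/-- aerated Catalan numbers -/
def cat2 (L : ℕ) : ℕ := if Even L then catalan (L / 2) else 0

open Finset in
lemma cat2_rec (L : ℕ) : cat2 (L + 1) = ∑ i ∈ range L, cat2 i * cat2 (L - 1 - i) := by
  rcases Nat.even_or_odd' L with ⟨m, rfl | rfl⟩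
  · rw [cat2, if_neg (by simp)]
    symm
    refine sum_eq_zero fun i hi => ?_
    rw [mem_range] at hi
    rw [mul_eq_zero]
    by_cases h : Even i
    · right; rw [cat2, if_neg]
      rw [Nat.even_iff] at *; omega
    · left; rw [cat2, if_neg h]
  · rw [cat2, if_pos (by rw [Nat.even_iff]; omega), show (2 * m + 1 + 1) / 2 = m + 1 by omega,
      catalan_succ, Fin.sum_univ_eq_sum_range (fun i => catalan i * catalan (m - i))]
    symm
    have : ∑ i ∈ range (2 * m + 1), cat2 i * cat2 (2 * m + 1 - 1 - i) =
      ∑ i ∈ (range (m + 1)).image (2 * ·), cat2 i * cat2 (2 * m + 1 - 1 - i) := by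
      symm
      apply sum_subset
      · intro x; simp; omega
      · intro x hx h
        rw [cat2, if_neg, zero_mul]
        rintro ⟨y, rfl⟩
        apply h
        simp at *
        exact ⟨y, by omega, by omega⟩
    rw [this, sum_image (by intro x _ y _; simp)]
    refine sum_congr rfl fun i hi => ?_
    rw [mem_range] at hi
    rw [cat2, cat2, if_pos (by simp), if_pos (by rw [Nat.even_iff]; omega)]
    congr 2 <;> omega

open Finset in
lemma NCF_card (n L : ℕ) : ∀ a, a + L ≤ n → #(NCF n a (a + L)) = cat2 L := by
  induction L using Nat.strong_induction_on with
  | _ L ih =>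
    intro a h
    rcases L with _ | L
    · simp [NCF_zero, cat2]
    · rw [← add_assoc, NCF_rec (by omega), cat2_rec]
      refine sum_congr rfl fun i hi => ?_
      rw [mem_range] at hi
      rw [ih i (by omega) _ (by omega)]
      have := ih (L - 1 - i) (by omega) (a + i + 2) (by omega)
      rw [← this]
      congr 3
      omega
section vpart
set_option linter.unusedSectionVars false
variable {n : ℕ} [NeZero n] (σ : Equiv.Perm (ZMod n))

/-- the class of a natural number -/
def cls (σ : Equiv.Perm (ZMod n)) (t : ZMod n) : Quot (fun a b : ZMod n => b = σ a + 1) :=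
  Quot.mk _ t

lemma cls_eq (t : ZMod n) : cls σ t = cls σ (σ t + 1) := Quot.sound rfl

/-- noncrossing -/
def NC (σ : Equiv.Perm (ZMod n)) : Prop :=
  ∀ i j, ¬ (i.val < j.val ∧ j.val < (σ i).val ∧ (σ i).val < (σ j).val)

/-- graph -/
def gr (σ : Equiv.Perm (ZMod n)) (S : Finset (ZMod n)) :
    SimpleGraph (Quot (fun a b : ZMod n => b = σ a + 1)) :=
  SimpleGraph.fromEdgeSet ((fun j => s(cls σ j, cls σ (j + 1))) '' (S : Set (ZMod n)))

lemma gr_reach {S : Finset (ZMod n)} {j : ZMod n} (hj : j ∈ S) :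
    (gr σ S).Reachable (cls σ j) (cls σ (j + 1)) := by
  by_cases h : cls σ j = cls σ (j + 1)
  · rw [← h]
  · apply SimpleGraph.Adj.reachable
    rw [gr, SimpleGraph.fromEdgeSet_adj]
    exact ⟨⟨j, hj, rfl⟩, h⟩

lemma gr_reach' {S : Finset (ZMod n)} (hσ : ∀ j, σ (σ j) = j) {j : ZMod n} (hj : σ j ∈ S) :
    (gr σ S).Reachable (cls σ j) (cls σ (j + 1)) := by
  have := gr_reach σ hj
  rw [← cls_eq, cls_eq σ (σ j), hσ] at this
  exact this.symm

lemma gr_interval {S : Finset (ZMod n)} (a b : ℕ) (hab : a ≤ b)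
    (h : ∀ t : ℕ, a ≤ t → t < b → (gr σ S).Reachable (cls σ (t : ZMod n)) (cls σ ((t : ZMod n) + 1))) :
    (gr σ S).Reachable (cls σ (a : ZMod n)) (cls σ (b : ZMod n)) := by
  induction b, hab using Nat.le_induction with
  | base => exact SimpleGraph.Reachable.refl _
  | succ m hm ih =>
    refine (ih fun t h1 h2 => h t h1 (by omega)).trans ?_
    push_cast
    exact h m hm (by omega)

lemma v_le_of_conn (S : Finset (ZMod n))
    (h : ∀ t : ZMod n, (gr σ S).Reachable (cls σ 0) (cls σ t)) : vfun n σ ≤ S.card + 1 := by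
  have hc : (gr σ S).Connected := by
    haveI : Nonempty (Quot (fun a b : ZMod n => b = σ a + 1)) := ⟨cls σ 0⟩
    refine ⟨fun x y => ?_⟩
    obtain ⟨x, rfl⟩ := Quot.exists_rep x
    obtain ⟨y, rfl⟩ := Quot.exists_rep y
    exact (h x).symm.trans (h y)
  have h1 := hc.card_vert_le_card_edgeSet_add_one
  refine h1.trans (Nat.add_le_add_right ?_ 1)
  have hf := (S.finite_toSet).image (fun j => s(cls σ j, cls σ (j + 1)))
  calc Nat.card (gr σ S).edgeSet = (gr σ S).edgeSet.ncard := rfl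
    _ ≤ ((fun j => s(cls σ j, cls σ (j + 1))) '' (S : Set (ZMod n))).ncard := by
        refine Set.ncard_le_ncard ?_ hf
        rw [gr, SimpleGraph.edgeSet_fromEdgeSet]
        exact Set.diff_subset
    _ ≤ (S : Set (ZMod n)).ncard := Set.ncard_image_le S.finite_toSet
    _ = S.card := Set.ncard_coe_finset S

/-- openers -/
def opn (σ : Equiv.Perm (ZMod n)) : Finset (ZMod n) :=
  haveI : Fintype (ZMod n) := ZMod.fintype n
  Finset.univ.filter fun j => j.val < (σ j).val

lemma mem_opn {j : ZMod n} : j ∈ opn σ ↔ j.val < (σ j).val := by simp [opn]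

lemma opn_or (hσ : ∀ j, σ (σ j) = j) (hf : ∀ j, σ j ≠ j) (j : ZMod n) : j ∈ opn σ ∨ σ j ∈ opn σ := by
  rw [mem_opn, mem_opn, hσ]
  have : (σ j).val ≠ j.val := fun h => hf j (ZMod.val_injective n h)
  omega

lemma opn_card (hσ : ∀ j, σ (σ j) = j) (hf : ∀ j, σ j ≠ j) : 2 * (opn σ).card = n := by
  classical
  haveI : Fintype (ZMod n) := ZMod.fintype n
  have h1 : (opn σ).card = (Finset.univ.filter fun j : ZMod n => ¬ j.val < (σ j).val).card := by
    refine Finset.card_bij (fun j _ => σ j) ?_ ?_ ?_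
    · intro j hj
      rw [mem_opn] at hj
      simp [hσ]; omega
    · intro i _ j _ h; exact σ.injective h
    · intro j hj
      refine ⟨σ j, ?_, hσ j⟩
      rcases opn_or σ hσ hf j with h | h
      · rw [mem_opn] at h; simp at hj; omega
      · exact h
  have h2 := Finset.card_filter_add_card_filter_not (s := (Finset.univ : Finset (ZMod n)))
    (fun j : ZMod n => j.val < (σ j).val)
  rw [← h1, Finset.card_univ, ZMod.card] at h2
  have : (opn σ).card = (Finset.univ.filter fun j : ZMod n => j.val < (σ j).val).card := by
    congr 1
    ext; simp [mem_opn]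
  omega

lemma reach_all {S : Finset (ZMod n)} (hσ : ∀ j, σ (σ j) = j) (t : ZMod n) (h : t ∈ S ∨ σ t ∈ S) :
    (gr σ S).Reachable (cls σ t) (cls σ (t + 1)) :=
  h.elim (gr_reach σ) (gr_reach' σ hσ)

lemma v_le (hσ : ∀ j, σ (σ j) = j) (hf : ∀ j, σ j ≠ j) : vfun n σ ≤ (opn σ).card + 1 := by
  apply v_le_of_conn
  intro t
  have := gr_interval σ (S := opn σ) 0 t.val (Nat.zero_le _)
    (fun t _ _ => reach_all σ hσ _ (opn_or σ hσ hf _))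
  simpa using this

lemma v_lt (hσ : ∀ j, σ (σ j) = j) (hf : ∀ j, σ j ≠ j) (hc : ¬ NC σ) :
    vfun n σ ≤ (opn σ).card := by
  classical
  simp only [NC, not_forall, not_not] at hc
  obtain ⟨i, j, h1, h2, h3⟩ := hc
  have hi : i ∈ opn σ := by rw [mem_opn]; omega
  have hcard := Finset.card_erase_add_one hi
  rw [← hcard]
  apply v_le_of_conn
  set S := (opn σ).erase i
  have key : ∀ t : ℕ, t < n → t ≠ i.val → t ≠ (σ i).val →
      (gr σ S).Reachable (cls σ (t : ZMod n)) (cls σ ((t : ZMod n) + 1)) := by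
    intro t htn ht1 ht2
    have hv : ((t : ZMod n)).val = t := ZMod.val_cast_of_lt htn
    apply reach_all σ hσ
    have e1 : (t : ZMod n) ≠ i := by intro h; rw [h] at hv; exact ht1 hv.symm
    have e2 : σ (t : ZMod n) ≠ i := by
      intro h; rw [← h, hσ, hv] at ht2; exact ht2 rfl
    rcases opn_or σ hσ hf t with h | h
    · left; exact Finset.mem_erase.2 ⟨e1, h⟩
    · right; exact Finset.mem_erase.2 ⟨e2, h⟩
  have ln := fun x : ZMod n => ZMod.val_lt x
  have lsi := ln (σ i)
  have lsj := ln (σ j)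
  -- reach inside
  have A : ∀ t : ℕ, i.val + 1 ≤ t → t ≤ (σ i).val →
      (gr σ S).Reachable (cls σ ((i.val + 1 : ℕ) : ZMod n)) (cls σ (t : ZMod n)) := by
    intro t ht1 ht2
    exact gr_interval σ _ _ ht1 fun s hs1 hs2 => key s (by omega) (by omega) (by omega)
  have B : ∀ t : ℕ, t ≤ i.val →
      (gr σ S).Reachable (cls σ 0) (cls σ (t : ZMod n)) := by
    intro t ht
    have := gr_interval σ (S := S) 0 t (Nat.zero_le _)
      fun s hs1 hs2 => key s (by omega) (by omega) (by omega)
    simpa using this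
  have C : ∀ t : ℕ, (σ i).val + 1 ≤ t → t ≤ n →
      (gr σ S).Reachable (cls σ 0) (cls σ (t : ZMod n)) := by
    intro t ht1 ht2
    have := gr_interval σ (S := S) t n ht2
      fun s hs1 hs2 => key s (by omega) (by omega) (by omega)
    simpa using this.symm
  have D : (gr σ S).Reachable (cls σ 0) (cls σ ((i.val + 1 : ℕ) : ZMod n)) := by
    have a := A j.val (by omega) (by omega)
    have c := C ((σ j).val + 1) (by omega) (by omega)
    push_cast at c
    rw [ZMod.natCast_zmod_val, ← cls_eq] at c
    rw [ZMod.natCast_zmod_val] at a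
    exact c.trans a.symm
  intro t
  have lt := ln t
  rw [← ZMod.natCast_zmod_val t]
  by_cases h : t.val ≤ i.val
  · exact B _ h
  by_cases h' : t.val ≤ (σ i).val
  · exact D.trans (A _ (by omega) h')
  · exact C _ (by omega) (by omega)

lemma v_ge (hσ : ∀ j, σ (σ j) = j) (hf : ∀ j, σ j ≠ j) (hc : NC σ) :
    (opn σ).card + 1 ≤ vfun n σ := by
  classical
  let E : ℕ → Set (ZMod n) := fun x => {i | i.val < x ∧ x ≤ (σ i).val}
  have ln := fun x : ZMod n => ZMod.val_lt x
  have hsucc : ∀ y : ZMod n, E (y + 1).val = E (y.val + 1) := by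
    intro y
    by_cases h : y.val + 1 < n
    · have e : y + 1 = ((y.val + 1 : ℕ) : ZMod n) := by
        push_cast; rw [ZMod.natCast_zmod_val]
      rw [e, ZMod.val_cast_of_lt h]
    · have h' : y.val + 1 = n := by have := ln y; omega
      have : y + 1 = 0 := by
        have : ((y.val + 1 : ℕ) : ZMod n) = 0 := by rw [h']; simp
        push_cast at this
        rwa [ZMod.natCast_zmod_val] at this
      rw [this, h']
      ext i
      have := ln (σ i)
      simp [E]
      omega
  have inv : ∀ x : ZMod n, E x.val = E (σ x + 1).val := by
    intro x
    rw [hsucc]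
    ext i
    simp only [E, Set.mem_ofPred_eq]
    have c1 := hc i x
    have c2 := hc x i
    have c3 := hc i (σ x)
    have c4 := hc (σ x) i
    rw [hσ] at c3 c4
    have e0 : (σ x).val ≠ x.val := fun h => hf x (ZMod.val_injective n h)
    by_cases h1 : i = x
    · subst h1; omega
    by_cases h2 : i = σ x
    · subst h2; rw [hσ]; omega
    have e1 : i.val ≠ x.val := fun h => h1 (ZMod.val_injective n h)
    have e2 : i.val ≠ (σ x).val := fun h => h2 (ZMod.val_injective n h)
    have e3 : (σ i).val ≠ x.val := fun h => h2 (by rw [← ZMod.val_injective n h, hσ])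
    have e4 : (σ i).val ≠ (σ x).val := fun h => h1 (σ.injective (ZMod.val_injective n h))
    omega
  let Eq' : Quot (fun a b : ZMod n => b = σ a + 1) → Set (ZMod n) :=
    Quot.lift (fun x => E x.val) (by rintro a b rfl; exact inv a)
  let F : Option (opn σ) → Quot (fun a b : ZMod n => b = σ a + 1) := fun o =>
    o.elim (cls σ 0) fun j => cls σ (j.1 + 1)
  have hF0 : Eq' (F none) = ∅ := by
    change E (0 : ZMod n).val = ∅
    ext i; simp [E]
  have hF1 : ∀ j : opn σ, Eq' (F (some j)) = E (j.1.val + 1) := fun j => hsucc j.1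
  have hmem : ∀ j : opn σ, j.1 ∈ E (j.1.val + 1) := by
    intro j
    have := (mem_opn σ).1 j.2
    simp only [E, Set.mem_ofPred_eq]; omega
  have hinj : Function.Injective F := by
    intro o p h
    have h := congrArg Eq' h
    rcases o with _ | i <;> rcases p with _ | j
    · rfl
    · rw [hF0, hF1] at h
      have := hmem j
      rw [← h] at this
      exact this.elim
    · rw [hF0, hF1] at h
      have := hmem i
      rw [h] at this
      exact this.elim
    · rw [hF1, hF1] at h
      have a := hmem i
      have b := hmem j
      rw [h] at a
      rw [← h] at b
      simp only [E, Set.mem_ofPred_eq] at a b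
      congr 1
      apply Subtype.ext
      apply ZMod.val_injective n
      omega
  haveI : Finite (Quot (fun a b : ZMod n => b = σ a + 1)) := inferInstance
  have := Nat.card_le_card_of_injective F hinj
  rw [vfun]
  simpa using this

end vpart

open Finset in
lemma NC_count (N : ℕ) [Fintype (Pairing (N + 1))] [DecidablePred fun σ : Pairing (N + 1) => NC σ.1] :
    #{σ : Pairing (N + 1) | NC σ.1} = #(NCF (N + 1) 0 (N + 1)) := by
  refine card_bij (fun σ _ => (σ.1 : Fin (N + 1) → Fin (N + 1))) ?_ ?_ ?_
  · intro σ hσ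
    rw [mem_filter] at hσ
    refine mem_NCF.2 ⟨σ.2.1, fun x => ?_, hσ.2⟩
    exact ⟨fun _ => ⟨Nat.zero_le _, x.2⟩, fun _ => σ.2.2 x⟩
  · intro σ _ τ _ h
    exact Subtype.ext (DFunLike.coe_injective h)
  · intro f hf
    obtain ⟨h1, h2, h3⟩ := mem_NCF.1 hf
    refine ⟨⟨Function.Involutive.toPerm (α := ZMod (N + 1)) f h1, h1,
      fun x => (h2 x).2 ⟨Nat.zero_le _, x.2⟩⟩, ?_, rfl⟩
    rw [mem_filter]
    exact ⟨mem_univ _, h3⟩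

theorem pairing_sum_tendsto_catalan (k : ℕ) (hk : 1 ≤ k) :
    haveI : NeZero (2 * k) := ⟨by omega⟩
    Tendsto
      (fun m : ℕ => ∑ σ : Pairing (2 * k), (m : ℝ) ^ ((vfun (2 * k) σ.1 : ℤ) - (k + 1 : ℤ)))
      atTop (nhds ((catalan k : ℕ) : ℝ)) := by
  classical
  haveI : NeZero (2 * k) := ⟨by omega⟩
  have hcount : (catalan k : ℝ) = ∑ σ : Pairing (2 * k), if NC σ.1 then (1 : ℝ) else 0 := by
    rw [Finset.sum_boole]
    congr 1
    have key : ∀ N : ℕ, ∀ _ : NeZero N, N = 2 * k → ∀ _ : Fintype (Pairing N),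
        catalan k = (Finset.univ.filter fun σ : Pairing N => NC σ.1).card := by
      intro N _ hN _
      obtain ⟨M, rfl⟩ : ∃ M, N = M + 1 := ⟨N - 1, by omega⟩
      have := NCF_card (M + 1) (M + 1) 0 (by omega)
      rw [zero_add] at this
      have h2 := NC_count M
      have h3 : cat2 (M + 1) = catalan k := by
        rw [cat2, hN, if_pos (by simp), Nat.mul_div_cancel_left _ (by norm_num)]
      rw [this, h3] at h2
      rw [← h2]
    exact key (2 * k) this rfl _
  rw [hcount]
  refine tendsto_finsetSum _ fun σ _ => ?_
  obtain ⟨σ, hσ, hf⟩ := σ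
  have hcard : (opn σ).card = k := by have := opn_card σ hσ hf; omega
  by_cases h : NC σ
  · have : vfun (2 * k) σ = k + 1 := by
      have := v_le σ hσ hf
      have := v_ge σ hσ hf h
      omega
    simp [h, this]
  · have := v_lt σ hσ hf h
    simp only [h, if_false]
    obtain ⟨d, hd⟩ : ∃ d : ℕ, (vfun (2 * k) σ : ℤ) - (k + 1 : ℤ) = -((d + 1 : ℕ) : ℤ) :=
      ⟨k - vfun (2 * k) σ, by omega⟩
    rw [hd]
    exact (tendsto_pow_neg_atTop (𝕜 := ℝ) (n := d + 1) (by omega)).comp tendsto_natCast_atTop_atTop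
end

section
/- For every pattern p : ZMod m → Fin n and every integer k ≥ 1, the limit L_{2k}(p) = lim_{N→∞, m∣N} N^{−(k+1)} · E[Tr(A_p(x)^{2k})] exists and satisfies L_{2k}(p) ≤ (2k−1)!!; moreover N^{−(k+3/2)} · E[Tr(A_p(x)^{2k+1})] → 0 as N → ∞ over positive multiples of m. Hence the patterned m-block circulant ensemble has limiting spectral moments which are bounded by the Gaussian moments. -/
open MeasureTheory Filter

/-- The index set `S_p(N)` for a pattern `p : ZMod m → Fin n`: the quotient of
`ZMod N × Fin n` by the smallest equivalence relation with
`(d, p r) ≈ (-d, p (r + ι d))` for all `d, r`. -/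
def SPidx (m n N : ℕ) (p : ZMod m → Fin n) (hm : m ∣ N) : Type :=
  Quot (fun a b : ZMod N × Fin n =>
    ∃ d r, a = (d, p r) ∧ b = (-d, p (r + ZMod.castHom hm (ZMod m) d)))

/-- The patterned `m`-block circulant matrix attached to `x : S_p(N) → ℝ`. -/
def APmat (m n N : ℕ) (p : ZMod m → Fin n) (hm : m ∣ N) (x : SPidx m n N p hm → ℝ) :
    Matrix (Fin N) (Fin N) ℝ :=
  fun i j => x (Quot.mk _ (((j : ℕ) : ZMod N) - ((i : ℕ) : ZMod N),
    p (ZMod.castHom hm (ZMod m) ((i : ℕ) : ZMod N))))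

/-- `E[Tr (A_p(x)^e)]` for the i.i.d. product measure with marginal `μ`. -/
noncomputable def expTraceP (μ : MeasureTheory.Measure ℝ) (m n N e : ℕ) (p : ZMod m → Fin n)
    (hm : m ∣ N) (hN : N ≠ 0) : ℝ :=
  haveI : NeZero N := ⟨hN⟩
  haveI : Finite (SPidx m n N p hm) := Finite.of_surjective _ (fun q => Quot.exists_rep q)
  haveI : Fintype (SPidx m n N p hm) := Fintype.ofFinite _
  ∫ x : SPidx m n N p hm → ℝ,
    Matrix.trace ((APmat m n N p hm x) ^ e) ∂(MeasureTheory.Measure.pi fun _ => μ)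


namespace PatAux
section
open scoped Classical
open Finset

noncomputable def mom (μ : Measure ℝ) (j : ℕ) : ℝ := ∫ t, t ^ j ∂μ

noncomputable def wt (μ : Measure ℝ) {e : ℕ} {S : Type} [Fintype S] (f : Fin e → S) : ℝ :=
  ∏ s, mom μ (#{l | f l = s})

lemma prod_fiber {e : ℕ} {S : Type} [Fintype S] (f : Fin e → S) (x : S → ℝ) :
    ∏ l, x (f l) = ∏ s, x s ^ (#{l | f l = s}) := by
  rw [← Finset.prod_fiberwise' (s := univ) (g := f) (f := x)]
  simp [Finset.prod_const]

lemma integral_wt (μ : Measure ℝ) [IsProbabilityMeasure μ] {e : ℕ} {S : Type} [Fintype S]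
    (f : Fin e → S) :
    ∫ x : S → ℝ, ∏ l, x (f l) ∂(Measure.pi fun _ => μ) = wt μ f := by
  simp_rw [prod_fiber f]
  exact integral_fintype_prod_eq_prod (μ := fun _ : S => μ)
    (fun (s : S) (t : ℝ) => t ^ (#{l | f l = s}))

lemma integrable_wt (μ : Measure ℝ) [IsProbabilityMeasure μ]
    (hmom : ∀ n' : ℕ, Integrable (fun x : ℝ => x ^ n') μ) {e : ℕ} {S : Type} [Fintype S]
    (f : Fin e → S) :
    Integrable (fun x : S → ℝ => ∏ l, x (f l)) (Measure.pi fun _ => μ) := by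
  simp_rw [prod_fiber f]
  exact Integrable.fintype_prod (μ := fun _ : S => μ)
    (f := fun (s : S) (t : ℝ) => t ^ (#{l | f l = s})) (fun s => hmom _)

lemma mom_zero (μ : Measure ℝ) [IsProbabilityMeasure μ] : mom μ 0 = 1 := by simp [mom]

lemma sum_fib {e : ℕ} {S : Type} [Fintype S] (f : Fin e → S) :
    ∑ s, #{l | f l = s} = e := by
  have := Finset.card_eq_sum_card_fiberwise (s := (univ : Finset (Fin e))) (t := univ) (f := f)
    (by intro x _; simp)
  simpa using this.symm

lemma wt_bound (μ : Measure ℝ) [IsProbabilityMeasure μ] (e : ℕ) :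
    ∃ C : ℝ, 0 ≤ C ∧ ∀ (S : Type) [Fintype S] (f : Fin e → S), |wt μ f| ≤ C := by
  set B : ℝ := 1 + ∑ j ∈ range (e + 1), |mom μ j| with hB
  have hB1 : 1 ≤ B := by
    have : 0 ≤ ∑ j ∈ range (e + 1), |mom μ j| := Finset.sum_nonneg (fun _ _ => abs_nonneg _)
    linarith
  refine ⟨B ^ e, by positivity, ?_⟩
  intro S _ f
  have : B ^ e = ∏ s, B ^ (#{l | f l = s}) := by
    rw [Finset.prod_pow_eq_pow_sum, sum_fib]
  rw [wt, Finset.abs_prod, this]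
  apply Finset.prod_le_prod
  · intros; exact abs_nonneg _
  intro s _
  by_cases h : #{l | f l = s} = 0
  · rw [h, mom_zero]; simp
  · have hle : #{l | f l = s} ≤ e := by
      simpa using Finset.card_le_univ ({l | f l = s} : Finset (Fin e))
    calc |mom μ (#{l | f l = s})| ≤ ∑ j ∈ range (e + 1), |mom μ j| :=
          Finset.single_le_sum (f := fun j => |mom μ j|) (fun _ _ => abs_nonneg _)
            (by simp; omega)
      _ ≤ B := by linarith
      _ ≤ B ^ _ := le_self_pow₀ hB1 h

lemma wt_zero (μ : Measure ℝ) (hmean : ∫ x : ℝ, x ∂μ = 0) {e : ℕ} {S : Type} [Fintype S]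
    (f : Fin e → S) (l : Fin e) (h : ∀ l', f l' = f l → l' = l) : wt μ f = 0 := by
  apply Finset.prod_eq_zero (Finset.mem_univ (f l))
  have : ({l' | f l' = f l} : Finset (Fin e)) = {l} := by
    ext l'; simp; constructor
    · exact h l'
    · rintro rfl; rfl
  rw [this]; simpa [mom] using hmean

lemma wt_one (μ : Measure ℝ) [IsProbabilityMeasure μ] (hvar : ∫ x : ℝ, x ^ 2 ∂μ = 1)
    {e : ℕ} {S : Type} [Fintype S]
    (f : Fin e → S) (π : Fin e → Fin e) (hπ : ∀ l, π l ≠ l)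
    (h : ∀ l l', f l' = f l ↔ l' = l ∨ l' = π l) : wt μ f = 1 := by
  apply Finset.prod_eq_one
  intro s _
  by_cases hs : ∃ l, f l = s
  · obtain ⟨l, rfl⟩ := hs
    have : ({l' | f l' = f l} : Finset (Fin e)) = {l, π l} := by
      ext l'; simp [h]
    rw [this, Finset.card_pair (hπ l).symm]; simpa [mom] using hvar
  · have : ({l' | f l' = s} : Finset (Fin e)) = ∅ := by
      ext l'; simp; exact fun h => hs ⟨l', h⟩
    rw [this]; simp [mom_zero]

def pos {G : Type} [AddCommGroup G] {e : ℕ} (d : Fin e → G) (l : Fin e) : G :=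
  ∑ j, if j < l then d j else 0

lemma pos_map {G H : Type} [AddCommGroup G] [AddCommGroup H] (φ : G →+ H) {e : ℕ}
    (d : Fin e → G) (l : Fin e) : φ (pos d l) = pos (fun j => φ (d j)) l := by
  simp only [pos, map_sum]
  apply Finset.sum_congr rfl
  intro j _
  split_ifs <;> simp

lemma pow_walk {G : Type} [AddCommGroup G] [Fintype G] [DecidableEq G] (B : Matrix G G ℝ) (e : ℕ) :
    ∀ a b, (B ^ e) a b = ∑ d : Fin e → G, if a + ∑ l, d l = b then
      ∏ l, B (a + pos d l) (a + pos d l + d l) else 0 := by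
  induction e with
  | zero => intro a b; simp [Matrix.one_apply]
  | succ e ih =>
    intro a b
    rw [pow_succ', Matrix.mul_apply, ← (Fin.consEquiv (fun _ => G)).sum_comp,
      Fintype.sum_prod_type, ← Equiv.sum_comp (Equiv.addLeft a)]
    apply Finset.sum_congr rfl
    intro c _
    rw [ih, Finset.mul_sum]
    apply Finset.sum_congr rfl
    intro d _
    simp only [Fin.consEquiv, Equiv.coe_fn_mk, Fin.sum_univ_succ, Fin.prod_univ_succ, pos,
      Fin.cons_zero, Fin.cons_succ, Equiv.coe_addLeft, Fin.succ_lt_succ_iff, Fin.succ_pos,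
      Fin.not_lt_zero, if_true, if_false, Finset.sum_const_zero, add_zero, zero_add, add_assoc, mul_ite,
      mul_zero]

lemma trace_walk {m n N : ℕ} [NeZero N] (p : ZMod m → Fin n) (hm : m ∣ N)
    (x : SPidx m n N p hm → ℝ) (e : ℕ) :
    Matrix.trace (APmat m n N p hm x ^ e) = ∑ a : ZMod N, ∑ d : Fin e → ZMod N,
      if ∑ l, d l = 0 then ∏ l, x (Quot.mk _ (d l, p (ZMod.castHom hm (ZMod m) (a + pos d l))))
      else 0 := by
  set B : Matrix (ZMod N) (ZMod N) ℝ := fun i j =>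
    x (Quot.mk _ (j - i, p (ZMod.castHom hm (ZMod m) i))) with hB
  have hbij : Function.Bijective (fun i : Fin N => ((i : ℕ) : ZMod N)) := by
    rw [Fintype.bijective_iff_injective_and_card]
    refine ⟨?_, by simp [ZMod.card]⟩
    intro i j hij
    have := (ZMod.natCast_eq_natCast_iff' _ _ _).1 hij
    rw [Nat.mod_eq_of_lt i.2, Nat.mod_eq_of_lt j.2] at this
    exact Fin.ext this
  let E : Fin N ≃ ZMod N := Equiv.ofBijective _ hbij
  have hA : APmat m n N p hm x = Matrix.reindexAlgEquiv ℝ ℝ E.symm B := by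
    ext i j
    rfl
  rw [hA, ← map_pow]
  have h1 : Matrix.trace (Matrix.reindexAlgEquiv ℝ ℝ E.symm (B ^ e)) =
      ∑ i : Fin N, (B ^ e) (E i) (E i) := rfl
  rw [h1, E.sum_comp (fun a => (B ^ e) a a)]
  apply Finset.sum_congr rfl
  intro a _
  refine (pow_walk B e a a).trans ?_
  apply Finset.sum_congr rfl
  intro d _
  simp [hB]

lemma sp_sign {m n N : ℕ} (p : ZMod m → Fin n) (hm : m ∣ N) (x y : ZMod N) (c c' : Fin n)
    (h : (Quot.mk _ (x, c) : SPidx m n N p hm) = Quot.mk _ (y, c')) : x = y ∨ x = -y := by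
  let F : SPidx m n N p hm → Sym2 (ZMod N) := Quot.lift (fun a => s(a.1, -a.1)) (by
    rintro a b ⟨d, r, rfl, rfl⟩
    simp [Sym2.eq_swap])
  have := congrArg F h
  simp only [F, Sym2.eq_iff] at this
  rcases this with h | h
  · exact Or.inl h.1
  · exact Or.inr h.1

def gen {m n : ℕ} (p : ZMod m → Fin n) (δ : ZMod m) (a b : Bool × Fin n) : Prop :=
  ∃ r, a = (true, p r) ∧ b = (false, p (r + δ))

lemma sp_iff {m n N : ℕ} (p : ZMod m → Fin n) (hm : m ∣ N) (d : ZMod N) (hd : d ≠ -d)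
    (c c' : Fin n) :
    (Quot.mk _ (d, c) : SPidx m n N p hm) = Quot.mk _ (-d, c') ↔
    Quot.mk (gen p (ZMod.castHom hm (ZMod m) d)) (true, c) = Quot.mk _ (false, c') := by
  constructor
  · intro h
    let F : SPidx m n N p hm → Option (Quot (gen p (ZMod.castHom hm (ZMod m) d))) :=
      Quot.lift (fun a => if a.1 = d then some (Quot.mk _ (true, a.2)) else
        if a.1 = -d then some (Quot.mk _ (false, a.2)) else none) (by
      rintro a b ⟨x, r, rfl, rfl⟩
      dsimp only
      by_cases h1 : x = d
      · subst h1
        rw [if_pos rfl, if_neg (Ne.symm hd), if_pos rfl]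
        exact congrArg some (Quot.sound ⟨r, rfl, rfl⟩)
      · by_cases h2 : x = -d
        · rw [if_neg h1, if_pos h2, if_pos (by rw [h2, neg_neg])]
          refine congrArg some (Quot.sound ⟨r + ZMod.castHom hm (ZMod m) x, rfl, ?_⟩).symm
          rw [h2, map_neg]; simp
        · rw [if_neg h1, if_neg h2, if_neg, if_neg]
          · intro h; exact h1 (neg_injective h)
          · intro h; exact h2 (by rw [← h, neg_neg]))
    have h2 := congrArg F h
    simp only [F] at h2
    rw [if_pos trivial, if_neg (Ne.symm hd), if_pos trivial] at h2
    exact Option.some.inj h2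
  · intro h
    let F : Quot (gen p (ZMod.castHom hm (ZMod m) d)) → SPidx m n N p hm :=
      Quot.lift (fun a => Quot.mk _ (if a.1 then d else -d, a.2)) (by
      rintro a b ⟨r, rfl, rfl⟩
      exact Quot.sound ⟨d, r, rfl, rfl⟩)
    exact congrArg F h

def sidx {m n N : ℕ} (p : ZMod m → Fin n) (hm : m ∣ N) {e : ℕ} (a : ZMod N) (d : Fin e → ZMod N)
    (l : Fin e) : SPidx m n N p hm :=
  Quot.mk _ (d l, p (ZMod.castHom hm (ZMod m) (a + pos d l)))

def Hrel {m n : ℕ} (p : ZMod m → Fin n) {e : ℕ} (π : Fin e → Fin e) (a : ZMod m)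
    (d : Fin e → ZMod m) : Prop :=
  ∀ l, Quot.mk (gen p (d l)) (true, p (a + pos d l)) = Quot.mk _ (false, p (a + pos d (π l)))

def Xp {m n N : ℕ} (p : ZMod m → Fin n) (hm : m ∣ N) {e : ℕ} (π : Fin e → Fin e) (a : ZMod N)
    (d : Fin e → ZMod N) : Prop :=
  (∀ l, d (π l) = - d l) ∧
    Hrel p π (ZMod.castHom hm (ZMod m) a) (fun l => ZMod.castHom hm (ZMod m) (d l))

noncomputable def PP (e : ℕ) : Finset (Fin e → Fin e) :=
  {π | Function.Involutive π ∧ ∀ l, π l ≠ l}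

def Qp {G : Type} [AddCommGroup G] {e : ℕ} (d : Fin e → G) : Prop :=
  ∀ l, ∃ l', l' ≠ l ∧ (d l' = d l ∨ d l' = - d l)

def Good {G : Type} [AddCommGroup G] {e : ℕ} (d : Fin e → G) : Prop :=
  ∃ π ∈ PP e, (∀ l, d (π l) = - d l) ∧ (∀ l, d l ≠ - d l) ∧
    ∀ l l', (d l' = d l ∨ d l' = - d l) → l' = l ∨ l' = π l

lemma wt_not_Q (μ : Measure ℝ) (hmean : ∫ x : ℝ, x ∂μ = 0)
    {m n N : ℕ} (p : ZMod m → Fin n) (hm : m ∣ N) [Fintype (SPidx m n N p hm)]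
    {e : ℕ} (a : ZMod N) (d : Fin e → ZMod N) (hQ : ¬ Qp d) : wt μ (sidx p hm a d) = 0 := by
  simp only [Qp, not_forall, not_exists, not_and] at hQ
  obtain ⟨l, hl⟩ := hQ
  apply wt_zero μ hmean _ l
  intro l' h
  by_contra hne
  exact hl l' hne (sp_sign p hm _ _ _ _ h)

lemma H_iff {m n N : ℕ} (p : ZMod m → Fin n) (hm : m ∣ N) {e : ℕ} (π : Fin e → Fin e) (a : ZMod N)
    (d : Fin e → ZMod N) (h1 : ∀ l, d (π l) = - d l) (h2 : ∀ l, d l ≠ - d l) :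
    Xp p hm π a d ↔ ∀ l, sidx p hm a d l = sidx p hm a d (π l) := by
  have key : ∀ l, ZMod.castHom hm (ZMod m) (a + pos d l) =
      ZMod.castHom hm (ZMod m) a + pos (fun l => ZMod.castHom hm (ZMod m) (d l)) l := by
    intro l
    rw [map_add]
    congr 1
    exact pos_map (ZMod.castHom hm (ZMod m)).toAddMonoidHom d l
  have : ∀ l, sidx p hm a d l = sidx p hm a d (π l) ↔ 
      Quot.mk (gen p (ZMod.castHom hm (ZMod m) (d l)))
        (true, p (ZMod.castHom hm (ZMod m) (a + pos d l))) =
        Quot.mk _ (false, p (ZMod.castHom hm (ZMod m) (a + pos d (π l)))) := by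
    intro l
    rw [← sp_iff p hm (d l) (h2 l), sidx, sidx, h1]
    exact Iff.rfl
  simp only [this, Xp, Hrel, key]
  exact ⟨fun h => h.2, fun h => ⟨h1, h⟩⟩

lemma pointwise (μ : Measure ℝ) [IsProbabilityMeasure μ] (hmean : ∫ x : ℝ, x ∂μ = 0)
    (hvar : ∫ x : ℝ, x ^ 2 ∂μ = 1)
    {m n N : ℕ} (p : ZMod m → Fin n) (hm : m ∣ N) [Fintype (SPidx m n N p hm)]
    {e : ℕ} (a : ZMod N) (d : Fin e → ZMod N) (h : ¬ (Qp d ∧ ¬ Good d)) :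
    wt μ (sidx p hm a d) = ∑ π ∈ PP e, if Xp p hm π a d then (1 : ℝ) else 0 := by
  by_cases hQ : Qp d
  · have hG : Good d := by
      by_contra hG; exact h ⟨hQ, hG⟩
    obtain ⟨π, hπ, h1, h2, h3⟩ := hG
    rw [Finset.sum_eq_single π]
    · have hπ' := hπ
      simp only [PP, mem_filter, mem_univ, true_and] at hπ'
      split_ifs with hX
      · rw [H_iff p hm π a d h1 h2] at hX
        apply wt_one μ hvar _ π hπ'.2
        intro l l'
        constructor
        · intro h; exact h3 _ _ (sp_sign p hm _ _ _ _ h)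
        · rintro (rfl | rfl)
          · rfl
          · exact (hX l).symm
      · rw [H_iff p hm π a d h1 h2] at hX
        push Not at hX
        obtain ⟨l, hl⟩ := hX
        apply wt_zero μ hmean _ l
        intro l' h
        rcases h3 _ _ (sp_sign p hm _ _ _ _ h) with h' | h'
        · exact h'
        · subst h'; exact absurd h.symm hl
    · intro π' hπ' hne
      rw [if_neg]
      intro hX
      apply hne
      funext l
      simp only [PP, mem_filter, mem_univ, true_and] at hπ'
      rcases h3 l (π' l) (Or.inr (hX.1 l)) with h | h
      · exact absurd h (hπ'.2 l)
      · exact h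
    · intro h; exact absurd hπ h
  · rw [wt_not_Q μ hmean p hm a d hQ, Finset.sum_eq_zero]
    intro π hπ
    rw [if_neg]
    intro hX
    simp only [PP, mem_filter, mem_univ, true_and] at hπ
    exact hQ fun l => ⟨π l, hπ.2 l, Or.inr (hX.1 l)⟩

lemma two_tors {N : ℕ} [NeZero N] (c : ZMod N) : #{y : ZMod N | y + y = c} ≤ 2 := by
  rcases Finset.eq_empty_or_nonempty ({y : ZMod N | y + y = c} : Finset (ZMod N)) with h | ⟨y0, h0⟩
  · rw [h]; simp
  · refine le_trans (Finset.card_le_card (t := {y0, y0 + ((N / 2 : ℕ) : ZMod N)}) ?_)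
      Finset.card_le_two
    intro y hy
    simp only [mem_filter, mem_univ, true_and, mem_insert, mem_singleton] at *
    have hz : (y - y0) + (y - y0) = 0 := by
      have : (y - y0) + (y - y0) = (y + y) - (y0 + y0) := by abel
      rw [this, hy, h0, sub_self]
    set z := y - y0 with hzd
    have hzv : ((z.val + z.val : ℕ) : ZMod N) = 0 := by
      push_cast; rw [ZMod.natCast_zmod_val]; exact hz
    rw [ZMod.natCast_eq_zero_iff] at hzv
    have hlt := ZMod.val_lt z
    obtain ⟨q, hq⟩ := hzv
    have hq2 : q < 2 := by
      by_contra hq2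
      have : N * 2 ≤ N * q := Nat.mul_le_mul_left _ (by omega)
      omega
    have hy : y = y0 + z := by rw [hzd]; abel
    have : z.val = 0 ∨ z.val = N / 2 := by
      interval_cases q <;> omega
    rcases this with h | h
    · left; rw [hy, (ZMod.val_eq_zero z).1 h, add_zero]
    · right; rw [hy, ← h, ZMod.natCast_zmod_val]

lemma card_det {N : ℕ} [NeZero N] {e : ℕ} (D : Finset (Fin e → ZMod N)) (T : Finset (Fin e))
    (h : ∀ d ∈ D, ∀ d' ∈ D, (∀ l ∈ T, d l = d' l) → ∀ l, d l + d l = d' l + d' l) :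
    #D ≤ 2 ^ e * N ^ (#T) := by
  let f : (Fin e → ZMod N) → (T → ZMod N) := fun d l => d l
  have h1 : #D ≤ 2 ^ e * #(D.image f) := by
    apply Finset.card_le_mul_card_image
    intro a ha
    obtain ⟨d0, hd0, rfl⟩ := Finset.mem_image.1 ha
    calc _ ≤ #(Fintype.piFinset fun l => ({y : ZMod N | y + y = d0 l + d0 l} : Finset (ZMod N))) := by
          apply Finset.card_le_card
          intro d hd
          simp only [mem_filter] at hd
          simp only [Fintype.mem_piFinset, mem_filter, mem_univ, true_and]
          apply h d hd.1 d0 hd0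
          intro l hl
          exact congrFun hd.2 ⟨l, hl⟩
      _ = ∏ l, #{y : ZMod N | y + y = d0 l + d0 l} := Fintype.card_piFinset _
      _ ≤ ∏ l : Fin e, 2 := Finset.prod_le_prod' (fun l _ => two_tors _)
      _ = 2 ^ e := by simp
  refine h1.trans (Nat.mul_le_mul_left _ ?_)
  refine (Finset.card_le_univ _).trans ?_
  simp [ZMod.card]

noncomputable def sig {G : Type} [AddCommGroup G] {e : ℕ} (d : Fin e → G) :
    Fin e → Fin e → Bool × Bool :=
  fun l l' => (decide (d l = d l'), decide (d l = - d l'))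

lemma sig_eq {G : Type} [AddCommGroup G] {e : ℕ} {d d' : Fin e → G} (h : sig d = sig d')
    (l l' : Fin e) : (d l = d l' ↔ d' l = d' l') ∧ (d l = - d l' ↔ d' l = - d' l') := by
  have := congrFun (congrFun h l) l'
  simpa [sig] using this

noncomputable def KK (e : ℕ) : ℕ := Fintype.card (Fin e → Fin e → Bool × Bool)

lemma card_sig {N : ℕ} [NeZero N] {e : ℕ} (D : Finset (Fin e → ZMod N)) (t : ℕ)
    (h : ∀ d0 ∈ D, ∃ T : Finset (Fin e), #T ≤ t ∧ ∀ d ∈ D, ∀ d' ∈ D, sig d = sig d0 →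
      sig d' = sig d0 → (∀ l ∈ T, d l = d' l) → ∀ l, d l + d l = d' l + d' l) :
    #D ≤ 2 ^ e * N ^ t * KK e := by
  have h1 : #D ≤ (2 ^ e * N ^ t) * #(D.image sig) := by
    apply Finset.card_le_mul_card_image
    intro a ha
    obtain ⟨d0, hd0, rfl⟩ := Finset.mem_image.1 ha
    obtain ⟨T, hT, hd⟩ := h d0 hd0
    refine (card_det _ T ?_).trans (Nat.mul_le_mul_left _
      (Nat.pow_le_pow_right (Nat.pos_of_ne_zero (NeZero.ne N)) hT))
    intro d hd1 d' hd2
    simp only [mem_filter] at hd1 hd2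
    exact hd d hd1.1 d' hd2.1 hd1.2 hd2.2
  exact h1.trans (Nat.mul_le_mul_left _ (Finset.card_le_univ _))

lemma exists_rep' {G : Type} [AddCommGroup G] {e : ℕ} (d : Fin e → G) :
    ∃ rep : Fin e → Fin e, (∀ l l', rep l = rep l' ↔ (d l = d l' ∨ d l = - d l')) ∧
      ∀ l, rep (rep l) = rep l := by
  let S : Setoid (Fin e) := ⟨fun l l' => d l = d l' ∨ d l = - d l', by
    refine ⟨fun x => Or.inl rfl, ?_, ?_⟩
    · rintro x y (h | h)
      · exact Or.inl h.symm
      · right; rw [h, neg_neg]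
    · rintro x y z (h | h) (h' | h')
      · left; rw [h, h']
      · right; rw [h, h']
      · right; rw [h, h']
      · left; rw [h, h', neg_neg]⟩
  refine ⟨fun l => (Quotient.mk S l).out, ?_, ?_⟩
  · intro l l'
    constructor
    · intro h
      have h2 : Quotient.mk S l = Quotient.mk S l' := by
        rw [← Quotient.out_eq (Quotient.mk S l), ← Quotient.out_eq (Quotient.mk S l')]
        exact congrArg _ h
      exact Quotient.exact h2
    · intro h
      have h2 : Quotient.mk S l = Quotient.mk S l' := Quotient.sound h
      exact congrArg Quotient.out h2
  · intro l
    exact congrArg Quotient.out (Quotient.out_eq (Quotient.mk S l))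

lemma rep_card {G : Type} [AddCommGroup G] {e : ℕ} (d : Fin e → G) (hQ : Qp d)
    (rep : Fin e → Fin e) (h1 : ∀ l l', rep l = rep l' ↔ (d l = d l' ∨ d l = - d l')) (l : Fin e) :
    2 ≤ #{l' | rep l' = rep l} := by
  obtain ⟨l', hne, h⟩ := hQ l
  have : ({l, l'} : Finset (Fin e)) ⊆ ({x | rep x = rep l} : Finset (Fin e)) := by
    intro x hx
    simp only [mem_insert, mem_singleton] at hx
    simp only [mem_filter, mem_univ, true_and]
    rcases hx with rfl | rfl
    · rfl
    · exact (h1 _ _).2 h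
  calc 2 = #({l, l'} : Finset (Fin e)) := (Finset.card_pair hne.symm).symm
    _ ≤ _ := Finset.card_le_card this

lemma rep_sum {e : ℕ} (rep : Fin e → Fin e) :
    e = ∑ r ∈ univ.image rep, #{l' | rep l' = r} := by
  have := Finset.card_eq_sum_card_image rep (univ : Finset (Fin e))
  simpa using this

lemma rep_le {G : Type} [AddCommGroup G] {e : ℕ} (d : Fin e → G) (hQ : Qp d)
    (rep : Fin e → Fin e) (h1 : ∀ l l', rep l = rep l' ↔ (d l = d l' ∨ d l = - d l')) :
    #(univ.image rep) * 2 ≤ e := by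
  conv_rhs => rw [rep_sum rep]
  rw [← smul_eq_mul]
  apply Finset.card_nsmul_le_sum
  intro r hr
  obtain ⟨l, _, rfl⟩ := Finset.mem_image.1 hr
  exact rep_card d hQ rep h1 l

/-- determination by representatives -/
lemma rep_det {G : Type} [AddCommGroup G] {e : ℕ} {d0 d d' : Fin e → G}
    (rep : Fin e → Fin e) (h1 : ∀ l l', rep l = rep l' ↔ (d0 l = d0 l' ∨ d0 l = - d0 l'))
    (h2 : ∀ l, rep (rep l) = rep l) (hd : sig d = sig d0) (hd' : sig d' = sig d0) (l : Fin e)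
    (h : d (rep l) = d' (rep l)) : d l = d' l := by
  rcases (h1 l (rep l)).1 (h2 l).symm with h3 | h3
  · rw [((sig_eq hd l (rep l)).1).2 h3, ((sig_eq hd' l (rep l)).1).2 h3, h]
  · rw [((sig_eq hd l (rep l)).2).2 h3, ((sig_eq hd' l (rep l)).2).2 h3, h]

lemma card_Q {N : ℕ} [NeZero N] {e k : ℕ} (hk : e < 2 * (k + 1)) :
    #{d : Fin e → ZMod N | Qp d} ≤ 2 ^ e * N ^ k * KK e := by
  apply card_sig
  intro d0 hd0
  simp only [mem_filter, mem_univ, true_and] at hd0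
  obtain ⟨rep, h1, h2⟩ := exists_rep' d0
  have := rep_le d0 hd0 rep h1
  refine ⟨univ.image rep, by omega, ?_⟩
  intro d _ d' _ hd hd' hT l
  rw [rep_det rep h1 h2 hd hd' l (hT _ (Finset.mem_image_of_mem _ (mem_univ _)))]

lemma card_bad {N : ℕ} [NeZero N] {k : ℕ} :
    #{d : Fin (2 * (k + 1)) → ZMod N | ∑ l, d l = 0 ∧ Qp d ∧ ¬ Good d} ≤
      2 ^ (2 * (k + 1)) * N ^ k * KK (2 * (k + 1)) := by
  apply card_sig
  intro d0 hd0
  simp only [mem_filter, mem_univ, true_and] at hd0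
  obtain ⟨hs0, hQ, hG⟩ := hd0
  obtain ⟨rep, h1, h2⟩ := exists_rep' d0
  have hle := rep_le d0 hQ rep h1
  by_cases hlt : #(univ.image rep) ≤ k
  · refine ⟨univ.image rep, hlt, ?_⟩
    intro d _ d' _ hd hd' hT l
    rw [rep_det rep h1 h2 hd hd' l (hT _ (Finset.mem_image_of_mem _ (mem_univ _)))]
  have hcard : #(univ.image rep) = k + 1 := by omega
  have hT : ∀ l, #((univ.image rep).erase (rep l)) ≤ k := by
    intro l
    rw [Finset.card_erase_of_mem (Finset.mem_image_of_mem _ (mem_univ _)), hcard]; simp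
  have hmemT : ∀ l l', rep l' ≠ rep l → rep l' ∈ (univ.image rep).erase (rep l) := by
    intro l l' h
    exact Finset.mem_erase.2 ⟨h, Finset.mem_image_of_mem _ (mem_univ _)⟩
  by_cases hself : ∃ l, d0 l = - d0 l
  · obtain ⟨l, hl⟩ := hself
    refine ⟨(univ.image rep).erase (rep l), hT l, ?_⟩
    intro d _ d' _ hd hd' hag l'
    by_cases hr : rep l' = rep l
    · have h3 : d0 l' = - d0 l' := by
        rcases (h1 _ _).1 hr with h | h
        · rw [h]; exact hl
        · rw [h, neg_neg]; exact hl.symm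
      have e1 := ((sig_eq hd l' l').2).2 h3
      have e2 := ((sig_eq hd' l' l').2).2 h3
      have f1 : d l' + d l' = 0 := by nth_rewrite 1 [e1]; simp
      have f2 : d' l' + d' l' = 0 := by nth_rewrite 1 [e2]; simp
      rw [f1, f2]
    · rw [rep_det rep h1 h2 hd hd' l' (hag _ (hmemT _ _ hr))]
  push Not at hself
  -- all fibres have exactly two elements
  have hfib : ∀ l, #{l' | rep l' = rep l} = 2 := by
    by_contra hcon
    push Not at hcon
    obtain ⟨l, hl⟩ := hcon
    have hlt : ∑ r ∈ univ.image rep, 2 < ∑ r ∈ univ.image rep, #{l' | rep l' = r} := by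
      apply Finset.sum_lt_sum
      · intro r hr
        obtain ⟨l, _, rfl⟩ := Finset.mem_image.1 hr
        exact rep_card d0 hQ rep h1 l
      · refine ⟨rep l, Finset.mem_image_of_mem _ (mem_univ _), ?_⟩
        exact lt_of_le_of_ne (rep_card d0 hQ rep h1 l) (Ne.symm hl)
    rw [← rep_sum rep, Finset.sum_const, hcard, smul_eq_mul] at hlt
    omega
  have hpi : ∀ l, ∃ l', l' ≠ l ∧ ∀ x, rep x = rep l ↔ x = l ∨ x = l' := by
    intro l
    obtain ⟨l', hne, h⟩ := hQ l
    refine ⟨l', hne, ?_⟩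
    have hsub : ({l, l'} : Finset (Fin (2 * (k + 1)))) = ({x | rep x = rep l} : Finset _) := by
      apply Finset.eq_of_subset_of_card_le
      · intro x hx
        simp only [mem_insert, mem_singleton] at hx
        simp only [mem_filter, mem_univ, true_and]
        rcases hx with rfl | rfl
        · rfl
        · exact (h1 _ _).2 h
      · rw [hfib, Finset.card_pair hne.symm]
    intro x
    have := Finset.ext_iff.1 hsub x
    simp only [mem_insert, mem_singleton, mem_filter, mem_univ, true_and] at this
    exact this.symm
  choose π hπne hπ using hpi
  have hrepπ : ∀ l, rep (π l) = rep l := fun l => (hπ l (π l)).2 (Or.inr rfl)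
  have hinv : Function.Involutive π := by
    intro l
    have h3 : rep (π (π l)) = rep l := by rw [hrepπ, hrepπ]
    rcases (hπ l _).1 h3 with h | h
    · exact h
    · exact absurd h (hπne _)
  by_cases hall : ∀ l, d0 (π l) = - d0 l
  · exfalso
    apply hG
    refine ⟨π, by simp only [PP, mem_filter, mem_univ, true_and]; exact ⟨hinv, hπne⟩, hall, hself, ?_⟩
    intro l l' h
    exact (hπ l l').1 ((h1 _ _).2 h)
  push Not at hall
  obtain ⟨l, hl⟩ := hall
  have hl2 : d0 (π l) = d0 l := by
    rcases (h1 _ _).1 (hrepπ l) with h | h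
    · exact h
    · exact absurd h hl
  refine ⟨(univ.image rep).erase (rep l), hT l, ?_⟩
  intro d hdm d' hdm' hd hd' hag
  simp only [mem_filter, mem_univ, true_and] at hdm hdm'
  have hoth : ∀ l', l' ≠ l → l' ≠ π l → d l' = d' l' := by
    intro l' n1 n2
    apply rep_det rep h1 h2 hd hd' l' (hag _ (hmemT _ _ ?_))
    intro h
    rcases (hπ l l').1 h with h | h
    · exact n1 h
    · exact n2 h
  have hp : d (π l) = d l := ((sig_eq hd _ _).1).2 hl2
  have hp' : d' (π l) = d' l := ((sig_eq hd' _ _).1).2 hl2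
  have hsum : ∀ g : Fin (2 * (k + 1)) → ZMod N, ∑ x, g x = g l + (g (π l) +
      ∑ x ∈ (univ.erase l).erase (π l), g x) := by
    intro g
    rw [Finset.add_sum_erase _ g (Finset.mem_erase.2 ⟨hπne l, mem_univ _⟩),
      Finset.add_sum_erase _ g (mem_univ _)]
  have hrest : ∑ x ∈ (univ.erase l).erase (π l), d x = ∑ x ∈ (univ.erase l).erase (π l), d' x := by
    apply Finset.sum_congr rfl
    intro x hx
    simp only [mem_erase, mem_univ, and_true] at hx
    exact hoth x hx.2 hx.1
  have s1 := hdm.1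
  have s2 := hdm'.1
  rw [hsum, hp, ← add_assoc] at s1
  rw [hsum, hp', ← add_assoc, ← hrest] at s2
  have hmain : d l + d l = d' l + d' l := add_right_cancel (s1.trans s2.symm)
  intro l'
  by_cases n1 : l' = l
  · rw [n1]; exact hmain
  by_cases n2 : l' = π l
  · rw [n2, hp, hp']; exact hmain
  rw [hoth l' n1 n2]

noncomputable def ext {G : Type} [AddCommGroup G] {e : ℕ} (π : Fin e → Fin e)
    (y : {l // l < π l} → G) (l : Fin e) : G :=
  if h : l < π l then y ⟨l, h⟩ else if h' : π l < π (π l) then - y ⟨π l, h'⟩ else 0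

lemma PP_mem {e : ℕ} {π : Fin e → Fin e} (h : π ∈ PP e) :
    Function.Involutive π ∧ ∀ l, π l ≠ l := by
  simpa only [PP, mem_filter, mem_univ, true_and] using h

lemma ext_anti {G : Type} [AddCommGroup G] {e : ℕ} {π : Fin e → Fin e} (hπ : π ∈ PP e)
    (y : {l // l < π l} → G) (l : Fin e) : ext π y (π l) = - ext π y l := by
  obtain ⟨h1, h2⟩ := PP_mem hπ
  have h3 : π (π l) = l := h1 l
  rcases lt_or_gt_of_ne (h2 l) with h | h
  · have a1 : π l < π (π l) := by rw [h3]; exact h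
    simp [ext, a1, not_lt.2 h.le]
  · have a1 : ¬ (π l < π (π l)) := by rw [h3]; exact not_lt.2 h.le
    have a2 : ¬ (π l < l) := not_lt.2 h.le
    simp [ext, h, h3, a2]

lemma ext_map {G H : Type} [AddCommGroup G] [AddCommGroup H] (φ : G →+ H) {e : ℕ}
    (π : Fin e → Fin e) (y : {l // l < π l} → G) :
    (fun l => φ (ext π y l)) = ext π (fun l => φ (y l)) := by
  funext l
  simp only [ext]
  split_ifs <;> simp

lemma card_ext {G : Type} [AddCommGroup G] [Fintype G] {e : ℕ} {π : Fin e → Fin e}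
    (hπ : π ∈ PP e) (R : (Fin e → G) → Prop) :
    #{d : Fin e → G | (∀ l, d (π l) = - d l) ∧ R d} =
      #{y : {l // l < π l} → G | R (ext π y)} := by
  symm
  have hr : ∀ y : {l // l < π l} → G, ∀ l : {l // l < π l}, ext π y l = y l := by
    intro y l; simp [ext, l.2]
  apply Finset.card_bij (fun y _ => ext π y)
  · intro y hy
    simp only [mem_filter, mem_univ, true_and] at hy ⊢
    exact ⟨ext_anti hπ y, hy⟩
  · intro y _ y' _ h
    funext l
    rw [← hr y, ← hr y', h]
  · intro d hd
    simp only [mem_filter, mem_univ, true_and] at hd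
    have : ext π (fun l => d l) = d := by
      funext l
      obtain ⟨h1, h2⟩ := PP_mem hπ
      have h3 : π (π l) = l := h1 l
      rcases lt_or_gt_of_ne (h2 l) with h | h
      · simp [ext, h3, h, not_lt.2 h.le, hd.1 l]
      · simp [ext, h]
    refine ⟨fun l => d l, ?_, this⟩
    simp only [mem_filter, mem_univ, true_and, this]
    exact hd.2

lemma card_T {k : ℕ} {π : Fin (2 * k) → Fin (2 * k)} (hπ : π ∈ PP (2 * k)) :
    Fintype.card {l // l < π l} = k := by
  obtain ⟨h1, h2⟩ := PP_mem hπ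
  rw [Fintype.card_subtype]
  have e1 : #{l | l < π l} = #{l | ¬ (l < π l)} := by
    apply Finset.card_bij (fun l _ => π l)
    · intro l hl
      simp only [mem_filter, mem_univ, true_and] at hl ⊢
      rw [h1 l]; exact not_lt.2 hl.le
    · intro l _ l' _ h; exact h1.injective h
    · intro l hl
      simp only [mem_filter, mem_univ, true_and] at hl
      refine ⟨π l, ?_, h1 l⟩
      simp only [mem_filter, mem_univ, true_and]
      rw [h1 l]; exact lt_of_le_of_ne (not_lt.1 hl) (h2 l)
  have e2 := Finset.card_filter_add_card_filter_not (s := (univ : Finset (Fin (2 * k))))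
    (fun l => l < π l)
  simp only [Finset.card_univ, Fintype.card_fin] at e2
  omega

lemma sum_fib_const {α β : Type} [Fintype α] [Fintype β] [DecidableEq β] (F : α → β) (M : ℕ)
    (h : ∀ b, #{a | F a = b} = M) (g : β → ℕ) : ∑ a, g (F a) = M * ∑ b, g b := by
  rw [← Finset.sum_fiberwise' (s := univ) (g := F) (f := g), Finset.mul_sum]
  apply Finset.sum_congr rfl
  intro b _
  rw [Finset.sum_const, h, smul_eq_mul]

lemma cast_fib {m M : ℕ} [NeZero m] [NeZero (m * M)] (hm : m ∣ m * M) (z : ZMod m) :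
    #{y : ZMod (m * M) | ZMod.castHom hm (ZMod m) y = z} = M := by
  have hsurj : Function.Surjective (ZMod.castHom hm (ZMod m)) := ZMod.castHom_surjective hm
  have hall : ∀ b, #{y : ZMod (m * M) | ZMod.castHom hm (ZMod m) y = b} =
      #{y : ZMod (m * M) | ZMod.castHom hm (ZMod m) y = z} := by
    intro b
    exact AddMonoidHom.card_fiber_eq_of_mem_range (ZMod.castHom hm (ZMod m)) (hsurj b) (hsurj z)
  have := sum_fib_const (ZMod.castHom hm (ZMod m)) _ hall (fun _ => 1)
  simp only [Finset.sum_const, Finset.card_univ, ZMod.card, smul_eq_mul, mul_one] at this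
  have hm0 : 0 < m := Nat.pos_of_ne_zero (NeZero.ne m)
  have h2 := this.trans (mul_comm _ m)
  exact (Nat.eq_of_mul_eq_mul_left hm0 h2).symm

lemma cast_fib_pi {m M : ℕ} [NeZero m] [NeZero (m * M)] (hm : m ∣ m * M) {T : Type} [Fintype T]
    [DecidableEq T] (z : T → ZMod m) :
    #{y : T → ZMod (m * M) | (fun l => ZMod.castHom hm (ZMod m) (y l)) = z} =
      M ^ Fintype.card T := by
  have : ({y : T → ZMod (m * M) | (fun l => ZMod.castHom hm (ZMod m) (y l)) = z} : Finset _) =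
      Fintype.piFinset
        (fun l => ({y : ZMod (m * M) | ZMod.castHom hm (ZMod m) y = z l} : Finset _)) := by
    ext y
    simp only [mem_filter, mem_univ, true_and, Fintype.mem_piFinset]
    exact funext_iff
  rw [this, Fintype.card_piFinset]
  simp only [cast_fib, Finset.prod_const, Finset.card_univ]

noncomputable def cc {m n : ℕ} [NeZero m] (p : ZMod m → Fin n) {e : ℕ} (π : Fin e → Fin e) : ℕ :=
  ∑ b : ZMod m, #{z : {l // l < π l} → ZMod m | Hrel p π b (ext π z)}

lemma cc_le {m n : ℕ} [NeZero m] (p : ZMod m → Fin n) {k : ℕ} {π : Fin (2 * k) → Fin (2 * k)}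
    (hπ : π ∈ PP (2 * k)) : cc p π ≤ m ^ (k + 1) := by
  calc cc p π ≤ ∑ b : ZMod m, m ^ k := by
        apply Finset.sum_le_sum
        intro b _
        refine (Finset.card_le_univ _).trans ?_
        simp only [Fintype.card_fun, ZMod.card, card_T hπ, le_refl]
    _ = m ^ (k + 1) := by simp [ZMod.card, pow_succ, mul_comm]

lemma count_X {m n M : ℕ} [NeZero m] [NeZero (m * M)] (p : ZMod m → Fin n) (hm : m ∣ m * M)
    {k : ℕ} {π : Fin (2 * k) → Fin (2 * k)} (hπ : π ∈ PP (2 * k)) :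
    ∑ a : ZMod (m * M), #{d : Fin (2 * k) → ZMod (m * M) | Xp p hm π a d} =
      M ^ (k + 1) * cc p π := by
  have h1 : ∀ a : ZMod (m * M), #{d : Fin (2 * k) → ZMod (m * M) | Xp p hm π a d} =
      M ^ k * #{z : {l // l < π l} → ZMod m |
        Hrel p π (ZMod.castHom hm (ZMod m) a) (ext π z)} := by
    intro a
    refine (Eq.trans ?_ (card_ext hπ (fun d => Hrel p π (ZMod.castHom hm (ZMod m) a)
      (fun l => ZMod.castHom hm (ZMod m) (d l))))).trans ?_
    · apply congrArg Finset.card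
      ext d
      simp only [mem_filter, mem_univ, true_and]
      exact Iff.rfl
    have h2 : ∀ y : {l // l < π l} → ZMod (m * M),
        (fun l => ZMod.castHom hm (ZMod m) (ext π y l)) =
          ext π (fun l => ZMod.castHom hm (ZMod m) (y l)) :=
      fun y => ext_map (ZMod.castHom hm (ZMod m)).toAddMonoidHom π y
    simp only [h2]
    rw [Finset.card_filter, Finset.card_filter]
    have := sum_fib_const
      (fun (y : {l // l < π l} → ZMod (m * M)) l => ZMod.castHom hm (ZMod m) (y l)) _
      (cast_fib_pi hm) (fun z => if Hrel p π (ZMod.castHom hm (ZMod m) a) (ext π z) then 1 else 0)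
    rw [card_T hπ] at this
    exact this
  simp only [h1]
  rw [← Finset.mul_sum, sum_fib_const (ZMod.castHom hm (ZMod m)) M (cast_fib hm)
    (fun b => #{z : {l // l < π l} → ZMod m | Hrel p π b (ext π z)}), ← mul_assoc, ← pow_succ]
  rfl

lemma PP_card (k : ℕ) : #(PP (2 * (k + 1))) ≤ Nat.doubleFactorial (2 * (k + 1) - 1) := by
  have h1 : #(PP (2 * (k + 1))) ≤ #({g | g.cycleType = Multiset.replicate (k + 1) 2} :
      Finset (Equiv.Perm (Fin (2 * (k + 1))))) := by
    apply Finset.card_le_card_of_surjOn 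
      (fun (g : Equiv.Perm (Fin (2 * (k + 1)))) (l : Fin (2 * (k + 1))) => g l)
    intro π hπ
    obtain ⟨hi, hne⟩ := PP_mem hπ
    refine ⟨hi.toPerm, ?_, rfl⟩
    have hsq : hi.toPerm ^ 2 = 1 := by
      ext l
      simp [pow_two, hi l]
    have hc := Equiv.Perm.cycleType_of_pow_prime_eq_one hsq
    have hsupp : hi.toPerm.support = univ := by
      ext l; simp [hne l]
    have hs := hi.toPerm.sum_cycleType
    rw [hsupp, hc, Multiset.sum_replicate] at hs
    simp only [smul_eq_mul, Finset.card_univ, Fintype.card_fin] at hs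
    have : hi.toPerm.cycleType.card = k + 1 := by omega
    rw [this] at hc
    exact Finset.mem_coe.2 (Finset.mem_filter.2 ⟨mem_univ _, hc⟩)
  refine h1.trans ?_
  rw [Equiv.Perm.card_of_cycleType]
  split_ifs with h
  · simp only [Fintype.card_fin, Multiset.sum_replicate, Multiset.prod_replicate, smul_eq_mul]
    have e1 : (2 * (k + 1)).factorial =
        (2 ^ (k + 1) * (k + 1).factorial) * Nat.doubleFactorial (2 * (k + 1) - 1) := by
      rw [← Nat.doubleFactorial_two_mul]
      exact Nat.factorial_eq_mul_doubleFactorial (2 * k + 1)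
    have e2 : 2 * (k + 1) - (k + 1) * 2 = 0 := by omega
    have e3 : (Multiset.replicate (k + 1) 2).toFinset = {2} := by
      rw [Multiset.toFinset_replicate, if_neg (Nat.succ_ne_zero k)]
    rw [e2, e1, e3, Finset.prod_singleton, Multiset.count_replicate_self, Nat.factorial_zero,
      one_mul]
    rw [Nat.mul_div_cancel_left _ (by positivity)]
  · exact Nat.zero_le _

lemma exp_eq (μ : Measure ℝ) [IsProbabilityMeasure μ]
    (hmom : ∀ n' : ℕ, Integrable (fun x : ℝ => x ^ n') μ) (m n N e : ℕ) [NeZero N]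
    (p : ZMod m → Fin n) (hm : m ∣ N) (hN : N ≠ 0) :
    ∃ _ : Fintype (SPidx m n N p hm), expTraceP μ m n N e p hm hN =
      ∑ a : ZMod N, ∑ d : Fin e → ZMod N,
        if ∑ l, d l = 0 then wt μ (sidx p hm a d) else 0 := by
  haveI : Finite (SPidx m n N p hm) := Finite.of_surjective _ (fun q => Quot.exists_rep q)
  refine ⟨Fintype.ofFinite _, ?_⟩
  letI : Fintype (SPidx m n N p hm) := Fintype.ofFinite _
  change ∫ x : SPidx m n N p hm → ℝ, Matrix.trace ((APmat m n N p hm x) ^ e)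
    ∂(MeasureTheory.Measure.pi fun _ => μ) = _
  simp_rw [trace_walk]
  have hint : ∀ (a : ZMod N) (d : Fin e → ZMod N),
      Integrable (fun x : SPidx m n N p hm → ℝ => if ∑ l, d l = 0 then
        ∏ l, x (sidx p hm a d l) else 0) (Measure.pi fun _ => μ) := by
    intro a d
    split_ifs
    · exact integrable_wt μ hmom _
    · exact integrable_zero _ _ _
  refine (integral_finset_sum _ (fun a _ => integrable_finset_sum _ (fun d _ => hint a d))).trans ?_
  apply Finset.sum_congr rfl
  intro a _
  refine (integral_finset_sum _ (fun d _ => hint a d)).trans ?_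
  apply Finset.sum_congr rfl
  intro d _
  split_ifs with h
  · exact integral_wt μ (sidx p hm a d)
  · simp

lemma odd_bound (μ : Measure ℝ) [IsProbabilityMeasure μ] (hmean : ∫ x : ℝ, x ∂μ = 0)
    (hmom : ∀ n' : ℕ, Integrable (fun x : ℝ => x ^ n') μ) (k : ℕ) :
    ∃ C : ℝ, 0 ≤ C ∧ ∀ (m n N : ℕ) (p : ZMod m → Fin n) (hm : m ∣ N) (hN : N ≠ 0),
      |expTraceP μ m n N (2 * k + 1) p hm hN| ≤ C * (N : ℝ) ^ (k + 1) := by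
  obtain ⟨C, hC0, hC⟩ := wt_bound μ (2 * k + 1)
  refine ⟨2 ^ (2 * k + 1) * KK (2 * k + 1) * C, by positivity, ?_⟩
  intro m n N p hm hN
  haveI : NeZero N := ⟨hN⟩
  obtain ⟨_, hE⟩ := exp_eq μ hmom m n N (2 * k + 1) p hm hN
  rw [hE]
  have hcard : ((#{d : Fin (2 * k + 1) → ZMod N | Qp d} : ℕ) : ℝ) ≤
      2 ^ (2 * k + 1) * (N : ℝ) ^ k * KK (2 * k + 1) := by
    exact_mod_cast card_Q (N := N) (e := 2 * k + 1) (k := k) (by omega)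
  calc _ ≤ ∑ a : ZMod N, ∑ d : Fin (2 * k + 1) → ZMod N, (if Qp d then C else 0) := by
        refine (Finset.abs_sum_le_sum_abs _ _).trans (Finset.sum_le_sum fun a _ => ?_)
        refine (Finset.abs_sum_le_sum_abs _ _).trans (Finset.sum_le_sum fun d _ => ?_)
        by_cases hQ : Qp d
        · rw [if_pos hQ]
          split_ifs
          · exact hC _ _
          · simpa using hC0
        · rw [if_neg hQ, wt_not_Q μ hmean p hm a d hQ]; simp
    _ = N * (#{d : Fin (2 * k + 1) → ZMod N | Qp d} * C) := by
        rw [← Finset.sum_filter]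
        simp [ZMod.card]
    _ ≤ N * ((2 ^ (2 * k + 1) * (N : ℝ) ^ k * KK (2 * k + 1)) * C) := by gcongr
    _ = _ := by ring

lemma even_bound (μ : Measure ℝ) [IsProbabilityMeasure μ] (hmean : ∫ x : ℝ, x ∂μ = 0)
    (hvar : ∫ x : ℝ, x ^ 2 ∂μ = 1)
    (hmom : ∀ n' : ℕ, Integrable (fun x : ℝ => x ^ n') μ) (k : ℕ) :
    ∃ C : ℝ, 0 ≤ C ∧ ∀ (m n M : ℕ) [NeZero m] (p : ZMod m → Fin n) (hm : m ∣ m * M)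
      (hN : m * M ≠ 0),
      |expTraceP μ m n (m * M) (2 * (k + 1)) p hm hN -
        (M : ℝ) ^ (k + 2) * ((∑ π ∈ PP (2 * (k + 1)), cc p π : ℕ) : ℝ)| ≤
        C * ((m * M : ℕ) : ℝ) ^ (k + 1) := by
  obtain ⟨C, hC0, hC⟩ := wt_bound μ (2 * (k + 1))
  set C1 : ℝ := C + #(PP (2 * (k + 1))) with hC1
  have hC10 : 0 ≤ C1 := by positivity
  refine ⟨2 ^ (2 * (k + 1)) * KK (2 * (k + 1)) * C1, by positivity, ?_⟩
  intro m n M _ p hm hN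
  haveI : NeZero (m * M) := ⟨hN⟩
  obtain ⟨_, hE⟩ := exp_eq μ hmom m n (m * M) (2 * (k + 1)) p hm hN
  rw [hE]
  set Bad : Finset (Fin (2 * (k + 1)) → ZMod (m * M)) :=
    {d | ∑ l, d l = 0 ∧ Qp d ∧ ¬ Good d} with hBad
  have hcard : ((#Bad : ℕ) : ℝ) ≤
      2 ^ (2 * (k + 1)) * ((m * M : ℕ) : ℝ) ^ k * KK (2 * (k + 1)) := by
    exact_mod_cast card_bad (N := m * M) (k := k)
  let S : ZMod (m * M) → (Fin (2 * (k + 1)) → ZMod (m * M)) → ℝ := fun a d =>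
    ∑ π ∈ PP (2 * (k + 1)), if Xp p hm π a d then (1 : ℝ) else 0
  have hS : (M : ℝ) ^ (k + 2) * ((∑ π ∈ PP (2 * (k + 1)), cc p π : ℕ) : ℝ) =
      ∑ a, ∑ d, S a d := by
    have h1 : ∀ a, ∑ d, S a d = ∑ π ∈ PP (2 * (k + 1)), ∑ d, 
        (if Xp p hm π a d then (1 : ℝ) else 0) := fun a => Finset.sum_comm
    simp only [h1]
    rw [Finset.sum_comm, Nat.cast_sum, Finset.mul_sum]
    apply Finset.sum_congr rfl
    intro π hπ
    have := count_X p hm hπ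
    have h2 := congrArg (Nat.cast : ℕ → ℝ) this
    push_cast at h2
    rw [← h2]
    apply Finset.sum_congr rfl
    intro a _
    rw [Finset.sum_boole]
  have hS0 : ∀ a d, ∑ l, d l ≠ 0 → S a d = 0 := by
    intro a d hd
    apply Finset.sum_eq_zero
    intro π hπ
    rw [if_neg]
    intro hX
    apply hd
    obtain ⟨h1, h2⟩ := PP_mem hπ
    apply Finset.sum_involution (fun l _ => π l)
    · intro l _; rw [hX.1 l]; simp
    · intro l _ _; exact h2 l
    · intro l _; exact mem_univ _
    · intro l _; exact h1 l
  have hSb : ∀ a d, |S a d| ≤ #(PP (2 * (k + 1))) := by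
    intro a d
    refine (Finset.abs_sum_le_sum_abs _ _).trans ?_
    calc _ ≤ ∑ π ∈ PP (2 * (k + 1)), (1 : ℝ) := by
          apply Finset.sum_le_sum
          intro π _
          split_ifs <;> simp
      _ = _ := by simp
  rw [hS, ← Finset.sum_sub_distrib]
  simp_rw [← Finset.sum_sub_distrib]
  calc _ ≤ ∑ a : ZMod (m * M), ∑ d, (if d ∈ Bad then C1 else 0) := by
        refine (Finset.abs_sum_le_sum_abs _ _).trans (Finset.sum_le_sum fun a _ => ?_)
        refine (Finset.abs_sum_le_sum_abs _ _).trans (Finset.sum_le_sum fun d _ => ?_)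
        by_cases hs : ∑ l, d l = 0
        · rw [if_pos hs]
          by_cases hb : Qp d ∧ ¬ Good d
          · have : d ∈ Bad := by
              simp only [hBad, mem_filter, mem_univ, true_and]; exact ⟨hs, hb⟩
            rw [if_pos this]
            exact (abs_sub _ _).trans (add_le_add (hC _ _) (hSb a d))
          · rw [pointwise μ hmean hvar p hm a d hb]
            simp only [S, sub_self, abs_zero]
            split_ifs
            · exact hC10
            · exact le_refl _
        · rw [if_neg hs, hS0 a d hs, sub_self, abs_zero]
          split_ifs
          · exact hC10
          · exact le_refl _
    _ = ((m * M : ℕ) : ℝ) * (#Bad * C1) := by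
        rw [← Finset.sum_filter]
        simp [ZMod.card]
    _ ≤ ((m * M : ℕ) : ℝ) *
        ((2 ^ (2 * (k + 1)) * ((m * M : ℕ) : ℝ) ^ k * KK (2 * (k + 1))) * C1) := by gcongr
    _ = _ := by ring

end
end PatAux

/-- for any patterned `m`-block circulant ensemble the limiting even spectral
moments exist and are bounded by the Gaussian moments `(2k-1)!!`, and the normalized odd
moments tend to `0`. -/
theorem patterned_moments_exist_and_bounded
    (μ : Measure ℝ) [IsProbabilityMeasure μ]
    (hmean : ∫ x : ℝ, x ∂μ = 0) (hvar : ∫ x : ℝ, x ^ 2 ∂μ = 1)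
    (hmom : ∀ n' : ℕ, Integrable (fun x : ℝ => x ^ n') μ)
    (m n : ℕ) (hm : 1 ≤ m) (hn : 1 ≤ n) (p : ZMod m → Fin n) (k : ℕ) (hk : 1 ≤ k) :
    (∃ L : ℝ, L ≤ (Nat.doubleFactorial (2 * k - 1) : ℝ) ∧
      Tendsto
        (fun j : ℕ =>
          (((m * (j + 1) : ℕ) : ℝ) ^ (k + 1))⁻¹ *
            expTraceP μ m n (m * (j + 1)) (2 * k) p (dvd_mul_right m (j + 1))
              (Nat.mul_ne_zero (by omega) (by omega)))
        atTop (nhds L)) ∧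
    Tendsto
      (fun j : ℕ =>
        (Real.sqrt ((m * (j + 1) : ℕ)) * ((m * (j + 1) : ℕ) : ℝ) ^ (k + 1))⁻¹ *
          expTraceP μ m n (m * (j + 1)) (2 * k + 1) p (dvd_mul_right m (j + 1))
            (Nat.mul_ne_zero (by omega) (by omega)))
      atTop (nhds 0) := by
  classical
  obtain ⟨k, rfl⟩ : ∃ k', k = k' + 1 := ⟨k - 1, by omega⟩
  haveI : NeZero m := ⟨by omega⟩
  have hmr : (1 : ℝ) ≤ m := by exact_mod_cast hm
  have hNge : ∀ j : ℕ, ((j : ℝ) + 1) ≤ ((m * (j + 1) : ℕ) : ℝ) := by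
    intro j
    push_cast
    have : (0 : ℝ) ≤ j := Nat.cast_nonneg j
    nlinarith
  have hNpos : ∀ j : ℕ, (0 : ℝ) < ((m * (j + 1) : ℕ) : ℝ) := by
    intro j
    have : (0 : ℝ) ≤ j := Nat.cast_nonneg j
    linarith [hNge j]
  constructor
  · obtain ⟨C, hC0, hC⟩ := PatAux.even_bound μ hmean hvar hmom k
    set s : ℕ := ∑ π ∈ PatAux.PP (2 * (k + 1)), PatAux.cc p π with hs
    refine ⟨(s : ℝ) / (m : ℝ) ^ (k + 2), ?_, ?_⟩
    · rw [div_le_iff₀ (by positivity)]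
      have h1 : s ≤ (PatAux.PP (2 * (k + 1))).card * m ^ (k + 2) := by
        rw [hs, ← smul_eq_mul]
        exact Finset.sum_le_card_nsmul _ _ _ (fun π hπ => PatAux.cc_le p hπ)
      have h2 := h1.trans (Nat.mul_le_mul_right _ (PatAux.PP_card k))
      exact_mod_cast h2
    · rw [tendsto_iff_norm_sub_tendsto_zero]
      have hlim : Tendsto (fun j : ℕ => C * (1 / ((j : ℝ) + 1))) atTop (nhds 0) := by
        simpa using tendsto_one_div_add_atTop_nhds_zero_nat.const_mul C
      refine squeeze_zero (fun _ => norm_nonneg _) ?_ hlim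
      intro j
      have hb := hC m n (j + 1) p (dvd_mul_right m (j + 1)) (Nat.mul_ne_zero (by omega) (by omega))
      have hp := hNpos j
      have hg := hNge j
      have hj : (0 : ℝ) < (j : ℝ) + 1 := by positivity
      have hsm : (((j + 1 : ℕ) : ℝ)) ^ (k + 2) * (s : ℝ) =
          ((m * (j + 1) : ℕ) : ℝ) ^ (k + 2) * ((s : ℝ) / (m : ℝ) ^ (k + 2)) := by
        push_cast
        rw [mul_pow]
        field_simp
      rw [hsm] at hb
      generalize expTraceP μ m n (m * (j + 1)) (2 * (k + 1)) p _ _ = E at hb ⊢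
      generalize (s : ℝ) / (m : ℝ) ^ (k + 2) = L at hb ⊢
      generalize ((m * (j + 1) : ℕ) : ℝ) = N at hb hp hg ⊢
      have e1 : (N ^ (k + 1 + 1))⁻¹ * E - L = (N ^ (k + 2))⁻¹ * (E - N ^ (k + 2) * L) := by
        field_simp
      rw [e1, Real.norm_eq_abs, abs_mul, abs_of_pos (by positivity)]
      calc (N ^ (k + 2))⁻¹ * |E - N ^ (k + 2) * L| ≤ (N ^ (k + 2))⁻¹ * (C * N ^ (k + 1)) := by
            gcongr
        _ = C * (1 / N) := by
            rw [pow_succ N (k + 1)]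
            field_simp
        _ ≤ C * (1 / ((j : ℝ) + 1)) := by gcongr
  · obtain ⟨C, hC0, hC⟩ := PatAux.odd_bound μ hmean hmom (k + 1)
    rw [tendsto_zero_iff_norm_tendsto_zero]
    have hlim : Tendsto (fun j : ℕ => C * Real.sqrt (1 / ((j : ℝ) + 1))) atTop (nhds 0) := by
      have h := (Real.continuous_sqrt.tendsto 0).comp
        (tendsto_one_div_add_atTop_nhds_zero_nat (𝕜 := ℝ))
      rw [Real.sqrt_zero] at h
      simpa using h.const_mul C
    refine squeeze_zero (fun _ => norm_nonneg _) ?_ hlim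
    intro j
    have hb := hC m n (m * (j + 1)) p (dvd_mul_right m (j + 1))
      (Nat.mul_ne_zero (by omega) (by omega))
    have hp := hNpos j
    have hg := hNge j
    have hj : (0 : ℝ) < (j : ℝ) + 1 := by positivity
    generalize expTraceP μ m n (m * (j + 1)) (2 * (k + 1) + 1) p _ _ = E at hb ⊢
    generalize ((m * (j + 1) : ℕ) : ℝ) = N at hb hp hg ⊢
    have hsq : 0 < Real.sqrt N := Real.sqrt_pos.2 hp
    rw [Real.norm_eq_abs, abs_mul, abs_of_pos (by positivity)]
    calc (Real.sqrt N * N ^ (k + 1 + 1))⁻¹ * |E|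
        ≤ (Real.sqrt N * N ^ (k + 1 + 1))⁻¹ * (C * N ^ (k + 1 + 1)) := by gcongr
      _ = C * Real.sqrt (1 / N) := by
          rw [Real.sqrt_div zero_le_one, Real.sqrt_one]
          field_simp
      _ ≤ C * Real.sqrt (1 / ((j : ℝ) + 1)) := by gcongr
end
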